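/- For every integer D ≥ 1 there exists a nonzero polynomial G in the variables (c_{ij})_{i+j≤D}, (a₁,a₂,b) and (u₁,u₂,u₃) such that whenever G ≠ 0 at these parameters, writing f_c := Σ_{i+j≤D} c_{ij} z₁^i z₂^j and ℓ(z) := a₁z₁ + a₂z₂ + b, the set {z ∈ (ℂ*)² : f_c(z) = 0, ℓ(z) ≠ 0, and there exists λ ∈ ℂ with u_i/z_i + u₃·a_i/ℓ(z) = λ·(∂f_c/∂z_i)(z) for i = 1,2} has exactly D² + D elements. (The first removal ML degree of a general degree-D very affine plane curve: r₁ = D² + D.) -/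

import Mathlib

open MvPolynomial

/-- Index set for the coefficients `c_{ij}` with `i + j ≤ D` of a plane curve of degree `D`. -/
abbrev CoeffIdx (D : ℕ) := {p : Fin (D + 1) × Fin (D + 1) // (p.1 : ℕ) + (p.2 : ℕ) ≤ D}

/-- The plane curve `f_c = Σ_{i+j≤D} c_{ij} z₁^i z₂^j` with coefficients `c`. -/
noncomputable def planeCurve (D : ℕ) (c : CoeffIdx D → ℂ) : MvPolynomial (Fin 2) ℂ :=
  ∑ p : CoeffIdx D, C (c p) * X 0 ^ (p.1.1 : ℕ) * X 1 ^ (p.1.2 : ℕ)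

/-- Polynomial maps into a space of larger dimension are not dominant. -/
lemma exists_ne_zero_eval_comp_eq_zero {σ τ : Type} [Fintype σ] [Fintype τ]
    (h : Fintype.card τ < Fintype.card σ) (φ : σ → MvPolynomial τ ℂ) :
    ∃ G : MvPolynomial σ ℂ, G ≠ 0 ∧ ∀ t : τ → ℂ, eval (fun s => eval t (φ s)) G = 0 := by
  have hφ : ¬ AlgebraicIndependent ℂ φ := by
    intro hi
    have h1 := hi.cardinalMk_le_trdeg
    rw [MvPolynomial.trdeg_of_isDomain] at h1
    simp at h1
    omega
  rw [algebraicIndependent_iff] at hφ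
  push Not at hφ
  obtain ⟨G, hG, hG0⟩ := hφ
  refine ⟨G, hG0, fun t => ?_⟩
  have h2 := congrArg (eval t) hG
  rw [map_zero] at h2
  rw [← h2, MvPolynomial.aeval_def, MvPolynomial.algebraMap_eq, MvPolynomial.eval₂_eq,
    MvPolynomial.eval_eq]
  simp

lemma sq_dvd_det_of_dvd_rows {ι R : Type*} [Fintype ι] [DecidableEq ι] [CommRing R]
    (A : Matrix ι ι R) (a : R) {i j : ι} (hij : i ≠ j) (hi : ∀ k, a ∣ A i k)
    (hj : ∀ k, a ∣ A j k) : a ^ 2 ∣ A.det := by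
  rw [← Matrix.det_transpose, Matrix.det_apply]
  refine Finset.dvd_sum fun σ _ => dvd_smul_of_dvd _ ?_
  have h : ∏ k ∈ {i, j}, A k (σ k) ∣ ∏ k, A k (σ k) :=
    Finset.prod_dvd_prod_of_subset _ _ _ (Finset.subset_univ _)
  rw [Finset.prod_pair hij] at h
  simp only [Matrix.transpose_apply]
  exact (sq a ▸ mul_dvd_mul (hi _) (hj _)).trans h

namespace Polynomial

/-- A row vector of powers times the Sylvester matrix. -/
lemma sum_pow_mul_sylvester {R : Type*} [CommRing R] (f g : R[X]) {m n : ℕ}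
    (hf : f.natDegree ≤ m) (hg : g.natDegree ≤ n) (y : R) (j : Fin (m + n)) :
    ∑ k : Fin (m + n), y ^ (k : ℕ) * sylvester f g m n k j =
      j.addCases (fun j₁ => y ^ (j₁ : ℕ) * g.eval y) (fun j₁ => y ^ (j₁ : ℕ) * f.eval y) := by
  have key : ∀ (h : R[X]) (a b : ℕ), h.natDegree ≤ a → b + a < m + n →
      ∑ k : Fin (m + n), y ^ (k : ℕ) *
        (if (k : ℕ) ∈ Set.Icc b (b + a) then h.coeff (k - b) else 0) = y ^ b * h.eval y := by
    intro h a b ha hab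
    rw [Fin.sum_univ_eq_sum_range
      (fun k => y ^ k * (if k ∈ Set.Icc b (b + a) then h.coeff (k - b) else 0)),
      eval_eq_sum_range' (Nat.lt_succ_of_le ha), Finset.mul_sum]
    symm
    refine Finset.sum_of_injOn (fun k => b + k) (fun _ _ _ _ h => by simpa using h) ?_ ?_ ?_
    · intro k hk
      simp only [Finset.coe_range, Set.mem_Iio] at hk ⊢
      omega
    · intro k _ hk
      rw [if_neg, mul_zero]
      rintro ⟨h1, h2⟩
      exact hk ⟨k - b, by simp; omega, by simp; omega⟩
    · intro k hk
      simp only [Finset.mem_range] at hk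
      rw [if_pos ⟨by simp, by simp; omega⟩, Nat.add_sub_cancel_left]
      ring
  induction j using Fin.addCases with
  | left j => simpa [sylvester] using key g n j hg (by omega)
  | right j => simpa [sylvester] using key f m j hf (by omega)

/-- Two distinct common zeros over the same abscissa give a double root of the resultant. -/
lemma sq_dvd_resultant_of_common_zeros {K : Type*} [Field K] [CharZero K] (f g : K[X][X])
    {m n : ℕ} (hf : f.natDegree ≤ m) (hg : g.natDegree ≤ n) (hmn : 2 ≤ m + n) {x y₁ y₂ : K}
    (hy : y₁ ≠ y₂) (hf₁ : f.evalEval x y₁ = 0) (hg₁ : g.evalEval x y₁ = 0)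
    (hf₂ : f.evalEval x y₂ = 0) (hg₂ : g.evalEval x y₂ = 0) :
    (X - C x) ^ 2 ∣ resultant f g m n := by
  let w : Fin (m + n) → K := fun k => y₁ + k * (y₂ - y₁)
  have hw : Function.Injective w := by
    intro a b h
    have : (a : K) = b := mul_right_cancel₀ (sub_ne_zero.2 hy.symm) (add_left_cancel h)
    exact Fin.ext (by exact_mod_cast this)
  let V : Matrix (Fin (m + n)) (Fin (m + n)) K[X] := (C (R := K)).mapMatrix (Matrix.vandermonde w)
  have hV : IsUnit V.det := by
    rw [← RingHom.map_det]
    exact isUnit_C.2 (isUnit_iff_ne_zero.2 (Matrix.det_vandermonde_ne_zero_iff.2 hw))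
  have hentry : ∀ i j, f.evalEval x (w i) = 0 → g.evalEval x (w i) = 0 →
      X - C x ∣ (V * sylvester f g m n) i j := by
    intro i j h1 h2
    have : (V * sylvester f g m n) i j =
        ∑ k : Fin (m + n), C (w i) ^ (k : ℕ) * sylvester f g m n k j := by
      simp [V, Matrix.mul_apply, Matrix.vandermonde]
    rw [this, sum_pow_mul_sylvester f g hf hg, dvd_iff_isRoot]
    simp only [evalEval] at h1 h2
    induction j using Fin.addCases <;> simp [h1, h2]
  have h0 : w ⟨0, by omega⟩ = y₁ := by simp [w]
  have h1 : w ⟨1, by omega⟩ = y₂ := by simp [w]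
  have := sq_dvd_det_of_dvd_rows (V * sylvester f g m n) (X - C x)
    (i := ⟨0, by omega⟩) (j := ⟨1, by omega⟩) (by simp)
    (fun k => hentry _ k (by rw [h0]; exact hf₁) (by rw [h0]; exact hg₁))
    (fun k => hentry _ k (by rw [h1]; exact hf₂) (by rw [h1]; exact hg₂))
  rw [Matrix.det_mul] at this
  exact hV.dvd_mul_left.1 this

/-- The total degree of a bivariate polynomial is at most `d`. -/
def TotalDegLE {R : Type*} [CommRing R] (d : ℕ) (f : R[X][X]) : Prop :=
  ∀ i k, d < i + k → (f.coeff k).coeff i = 0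

namespace TotalDegLE
variable {R : Type*} [CommRing R] {d e : ℕ} {f g : R[X][X]}

lemma natDegree_le (h : TotalDegLE d f) : f.natDegree ≤ d := by
  rw [natDegree_le_iff_coeff_eq_zero]
  intro k hk
  ext i
  simpa using h i k (by omega)

lemma add (hf : TotalDegLE d f) (hg : TotalDegLE d g) : TotalDegLE d (f + g) := by
  intro i k h
  simp [hf i k h, hg i k h]

lemma sub (hf : TotalDegLE d f) (hg : TotalDegLE d g) : TotalDegLE d (f - g) := by
  intro i k h
  simp [hf i k h, hg i k h]

lemma sum {ι : Type*} (s : Finset ι) (F : ι → R[X][X]) (h : ∀ q ∈ s, TotalDegLE d (F q)) :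
    TotalDegLE d (∑ q ∈ s, F q) := by
  intro i k hik
  simp only [finsetSum_coeff]
  exact Finset.sum_eq_zero fun q hq => h q hq i k hik

lemma mul (hf : TotalDegLE d f) (hg : TotalDegLE e g) : TotalDegLE (d + e) (f * g) := by
  intro i k h
  rw [coeff_mul, finsetSum_coeff]
  refine Finset.sum_eq_zero fun a ha => ?_
  rw [coeff_mul]
  refine Finset.sum_eq_zero fun b hb => ?_
  rw [Finset.HasAntidiagonal.mem_antidiagonal] at ha hb
  by_cases h1 : d < b.1 + a.1
  · rw [hf _ _ h1, zero_mul]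
  · rw [hg _ _ (by omega), mul_zero]

lemma C_C_mul_X_pow_mul_X_pow (a : R) {i j : ℕ} (h : i + j ≤ d) :
    TotalDegLE d (C (C a * X ^ i) * X ^ j) := by
  intro i' j' h'
  rw [coeff_C_mul, coeff_X_pow]
  split_ifs with h1
  · rw [mul_one, coeff_C_mul, coeff_X_pow, if_neg (by omega), mul_zero]
  · simp

end TotalDegLE

/-- The resultant of bivariate polynomials has degree at most the product of the degrees. -/
lemma natDegree_resultant_le {R : Type*} [CommRing R] {f g : R[X][X]} {m n : ℕ}
    (hf : TotalDegLE m f) (hg : TotalDegLE n g) : (resultant f g m n).natDegree ≤ m * n := by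
  rw [resultant, Matrix.det_apply]
  refine natDegree_sum_le_of_forall_le _ _ fun σ _ => ?_
  refine (natDegree_smul_le _ _).trans ?_
  by_cases h0 : ∃ j, sylvester f g m n (σ j) j = 0
  · obtain ⟨j, hj⟩ := h0
    have : ∏ i, sylvester f g m n (σ i) i = 0 := Finset.prod_eq_zero (Finset.mem_univ j) hj
    simp [this]
  push Not at h0
  have hdeg : ∀ j : Fin (m + n), (sylvester f g m n (σ j) j).natDegree + (σ j : ℕ) ≤
      j.addCases (fun j₁ => n + (j₁ : ℕ)) (fun j₁ => m + (j₁ : ℕ)) := by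
    have key : ∀ (h : R[X][X]) (a b k : ℕ), TotalDegLE a h → b ≤ k → h.coeff (k - b) ≠ 0 →
        (h.coeff (k - b)).natDegree + k ≤ a + b := by
      intro h a b k ha hb hne
      by_contra hlt
      have := ha (h.coeff (k - b)).natDegree (k - b) (by omega)
      exact hne (leadingCoeff_eq_zero.1 this)
    intro j
    have hj := h0 j
    generalize σ j = k at hj ⊢
    induction j using Fin.addCases with
    | left j =>
      simp only [sylvester, Matrix.of_apply, Fin.addCases_left] at hj ⊢
      split_ifs at hj ⊢ with h
      · exact key g n j k hg h.1 hj
      · exact absurd rfl hj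
    | right j =>
      simp only [sylvester, Matrix.of_apply, Fin.addCases_right] at hj ⊢
      split_ifs at hj ⊢ with h
      · exact key f m j k hf h.1 hj
      · exact absurd rfl hj
  have hsum := Finset.sum_le_sum fun j (_ : j ∈ Finset.univ) => hdeg j
  have h1 : ∑ k, (σ k : ℕ) = ∑ k : Fin m, (k : ℕ) + (n * m + ∑ k : Fin n, (k : ℕ)) := by
    rw [Equiv.sum_comp σ (fun k => (k : ℕ)), Fin.sum_univ_add]
    simp [Finset.sum_add_distrib]
  have h2 : ∑ j : Fin (m + n), (j.addCases (fun j₁ => n + (j₁ : ℕ)) (fun j₁ => m + (j₁ : ℕ)) : ℕ)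
      = (m * n + ∑ k : Fin m, (k : ℕ)) + (n * m + ∑ k : Fin n, (k : ℕ)) := by
    rw [Fin.sum_univ_add]
    simp [Finset.sum_add_distrib]
  rw [Finset.sum_add_distrib, h1, h2] at hsum
  refine (natDegree_prod_le _ _).trans ?_
  omega

/-- Over an algebraically closed field the resultant detects common roots. -/
lemma resultant_eq_zero_iff_exists_root {K : Type*} [Field K] [IsAlgClosed K] {f g : K[X]}
    {m n : ℕ} (hf : f.natDegree = m) (hf0 : f ≠ 0) (hg : g.natDegree ≤ n) :
    resultant f g m n = 0 ↔ ∃ y, f.eval y = 0 ∧ g.eval y = 0 := by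
  subst hf
  rw [resultant_eq_prod_eval f g n hg (IsAlgClosed.splits f)]
  simp [hf0, Multiset.prod_eq_zero_iff]

end Polynomial

lemma exists_finset_pow_eq (n : ℕ) (hn : n ≠ 0) {a : ℂ} (ha : a ≠ 0) :
    ∃ s : Finset ℂ, s.card = n ∧ ∀ x, x ∈ s ↔ x ^ n = a := by
  have hsep : (Polynomial.X ^ n - Polynomial.C a).Separable :=
    Polynomial.separable_X_pow_sub_C a (by exact_mod_cast hn) ha
  have hne : (Polynomial.X ^ n - Polynomial.C a) ≠ 0 :=
    (Polynomial.monic_X_pow_sub_C a hn).ne_zero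
  refine ⟨(Polynomial.X ^ n - Polynomial.C a).roots.toFinset, ?_, fun x => ?_⟩
  · rw [Multiset.toFinset_card_of_nodup (Polynomial.nodup_roots hsep),
      ← (IsAlgClosed.splits _).natDegree_eq_card_roots, Polynomial.natDegree_X_pow_sub_C]
  · simp [hne, sub_eq_zero]
/-- The index of the monomial `z₁^i z₂^j`. -/
def coeffIdx {D : ℕ} (i j : ℕ) (h : i + j ≤ D) : CoeffIdx D :=
  ⟨(⟨i, by omega⟩, ⟨j, by omega⟩), h⟩

@[simp]
lemma coeffIdx_inj {D i j i' j' : ℕ} (h : i + j ≤ D) (h' : i' + j' ≤ D) :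
    coeffIdx i j h = coeffIdx i' j' h' ↔ i = i' ∧ j = j' := by
  simp [coeffIdx]

section CurveValues
variable {D : ℕ} {A B : Type*} [CommRing A] [CommRing B]

/-- The value at `(x, y)` of the curve polynomial with coefficients `c`. -/
def curveVal (c : CoeffIdx D → A) (x y : A) : A :=
  ∑ q, c q * x ^ (q.1.1 : ℕ) * y ^ (q.1.2 : ℕ)

/-- The value at `(x, y)` of the first partial derivative of the curve polynomial. -/
def curveDx (c : CoeffIdx D → A) (x y : A) : A :=
  ∑ q, c q * ((q.1.1 : ℕ) * x ^ ((q.1.1 : ℕ) - 1)) * y ^ (q.1.2 : ℕ)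

/-- The value at `(x, y)` of the second partial derivative of the curve polynomial. -/
def curveDy (c : CoeffIdx D → A) (x y : A) : A :=
  ∑ q, c q * x ^ (q.1.1 : ℕ) * ((q.1.2 : ℕ) * y ^ ((q.1.2 : ℕ) - 1))

lemma map_curveVal (φ : A →+* B) (c : CoeffIdx D → A) (x y : A) :
    φ (curveVal c x y) = curveVal (fun q => φ (c q)) (φ x) (φ y) := by
  simp [curveVal]

lemma map_curveDx (φ : A →+* B) (c : CoeffIdx D → A) (x y : A) :
    φ (curveDx c x y) = curveDx (fun q => φ (c q)) (φ x) (φ y) := by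
  simp [curveDx]

lemma map_curveDy (φ : A →+* B) (c : CoeffIdx D → A) (x y : A) :
    φ (curveDy c x y) = curveDy (fun q => φ (c q)) (φ x) (φ y) := by
  simp [curveDy]

lemma curveVal_add (c c' : CoeffIdx D → A) (x y : A) :
    curveVal (c + c') x y = curveVal c x y + curveVal c' x y := by
  simp [curveVal, add_mul, Finset.sum_add_distrib]

lemma curveDx_add (c c' : CoeffIdx D → A) (x y : A) :
    curveDx (c + c') x y = curveDx c x y + curveDx c' x y := by
  simp [curveDx, add_mul, Finset.sum_add_distrib]

lemma curveDy_add (c c' : CoeffIdx D → A) (x y : A) :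
    curveDy (c + c') x y = curveDy c x y + curveDy c' x y := by
  simp [curveDy, add_mul, Finset.sum_add_distrib]

lemma curveVal_single (i j : ℕ) (h : i + j ≤ D) (a x y : A) :
    curveVal (Pi.single (coeffIdx i j h) a) x y = a * x ^ i * y ^ j := by
  rw [curveVal, Finset.sum_eq_single (coeffIdx i j h)]
  · simp [coeffIdx]
  · intro q _ hq
    simp [hq]
  · simp

lemma curveDx_single (i j : ℕ) (h : i + j ≤ D) (a x y : A) :
    curveDx (Pi.single (coeffIdx i j h) a) x y = a * (i * x ^ (i - 1)) * y ^ j := by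
  rw [curveDx, Finset.sum_eq_single (coeffIdx i j h)]
  · simp [coeffIdx]
  · intro q _ hq
    simp [hq]
  · simp

lemma curveDy_single (i j : ℕ) (h : i + j ≤ D) (a x y : A) :
    curveDy (Pi.single (coeffIdx i j h) a) x y = a * x ^ i * (j * y ^ (j - 1)) := by
  rw [curveDy, Finset.sum_eq_single (coeffIdx i j h)]
  · simp [coeffIdx]
  · intro q _ hq
    simp [hq]
  · simp

end CurveValues

lemma eval_planeCurve {D : ℕ} (c : CoeffIdx D → ℂ) (z : Fin 2 → ℂ) :
    eval z (planeCurve D c) = curveVal c (z 0) (z 1) := by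
  simp [planeCurve, curveVal]

lemma eval_pderiv_zero_planeCurve {D : ℕ} (c : CoeffIdx D → ℂ) (z : Fin 2 → ℂ) :
    eval z (pderiv 0 (planeCurve D c)) = curveDx c (z 0) (z 1) := by
  simp only [planeCurve, curveDx, map_sum]
  refine Finset.sum_congr rfl fun q _ => ?_
  simp [Derivation.leibniz, Derivation.leibniz_pow, pderiv_X]
  ring

lemma eval_pderiv_one_planeCurve {D : ℕ} (c : CoeffIdx D → ℂ) (z : Fin 2 → ℂ) :
    eval z (pderiv 1 (planeCurve D c)) = curveDy c (z 0) (z 1) := by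
  simp only [planeCurve, curveDy, map_sum]
  refine Finset.sum_congr rfl fun q _ => ?_
  simp [Derivation.leibniz, Derivation.leibniz_pow, pderiv_X]

/-- The parameter space: curve coefficients, hyperplane parameters, and data. -/
abbrev Param (D : ℕ) := CoeffIdx D ⊕ (Fin 3 ⊕ Fin 3)

/-- The affine-linear form `a₁ x + a₂ y + b`. -/
def linVal {A : Type*} [CommRing A] (v : Fin 3 → A) (x y : A) : A := v 0 * x + v 1 * y + v 2

section Incidence
variable {D : ℕ}

/-- The parameters which are solved for when a point, the gradient of the curve and the value of
the affine-linear form there are prescribed. -/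
def solvedParams (hD : 1 ≤ D) : Finset (Param D) :=
  {.inl (coeffIdx 0 0 (by omega)), .inl (coeffIdx 1 0 (by omega)),
    .inl (coeffIdx 0 1 (by omega)), .inr (.inl 2)}

lemma card_solvedParams (hD : 1 ≤ D) : (solvedParams hD).card = 4 := by
  simp [solvedParams]

/-- The unsolved parameters together with three auxiliary ones. -/
abbrev AuxParam (hD : 1 ≤ D) := {q : Param D // q ∉ solvedParams hD} ⊕ Fin 3

/-- Points of the auxiliary space. -/
def auxPoint (hD : 1 ≤ D) (p : Param D → ℂ) (r : Fin 3 → ℂ) : AuxParam hD → ℂ :=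
  Sum.elim (fun q => p q.1) r

/-- Parameters admitting a point at which the position, the gradient of the curve and the value
of the affine-linear form are prescribed by three auxiliary parameters lie in a hypersurface. -/
lemma exists_hypersurface_of_incidence (hD : 1 ≤ D) (x y g₀ g₁ s : MvPolynomial (AuxParam hD) ℂ) :
    ∃ G : MvPolynomial (Param D) ℂ, G ≠ 0 ∧ ∀ (c : CoeffIdx D → ℂ) (v u : Fin 3 → ℂ),
      (∃ r, let t := auxPoint hD (Sum.elim c (Sum.elim v u)) r
        curveVal c (eval t x) (eval t y) = 0 ∧ curveDx c (eval t x) (eval t y) = eval t g₀ ∧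
        curveDy c (eval t x) (eval t y) = eval t g₁ ∧
        linVal v (eval t x) (eval t y) = eval t s) →
      eval (Sum.elim c (Sum.elim v u)) G = 0 := by
  classical
  let c' : CoeffIdx D → MvPolynomial (AuxParam hD) ℂ := fun q =>
    if h : .inl q ∈ solvedParams hD then 0 else X (.inl ⟨.inl q, h⟩)
  let k₁₀ := g₀ - curveDx c' x y
  let k₀₁ := g₁ - curveDy c' x y
  let k₀₀ := - curveVal c' x y - k₁₀ * x - k₀₁ * y
  let b := s - X (.inl ⟨.inr (.inl 0), by simp [solvedParams]⟩) * x
    - X (.inl ⟨.inr (.inl 1), by simp [solvedParams]⟩) * y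
  let φ : Param D → MvPolynomial (AuxParam hD) ℂ := fun q =>
    if h : q ∈ solvedParams hD then
      if q = .inl (coeffIdx 0 0 (by omega)) then k₀₀
      else if q = .inl (coeffIdx 1 0 (by omega)) then k₁₀
      else if q = .inl (coeffIdx 0 1 (by omega)) then k₀₁ else b
    else X (.inl ⟨q, h⟩)
  have hcard : Fintype.card (AuxParam hD) < Fintype.card (Param D) := by
    have h1 := card_solvedParams hD
    have h2 := (solvedParams hD).card_le_univ
    rw [Fintype.card_sum, Fintype.card_subtype_compl, Fintype.card_coe, Fintype.card_fin]
    omega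
  obtain ⟨G, hG, hv⟩ := exists_ne_zero_eval_comp_eq_zero hcard φ
  refine ⟨G, hG, ?_⟩
  rintro c v u ⟨r, h1, h2, h3, h4⟩
  rw [← hv (auxPoint hD (Sum.elim c (Sum.elim v u)) r)]
  set t := auxPoint hD (Sum.elim c (Sum.elim v u)) r with ht
  have hc : c = (fun q => eval t (c' q))
      + Pi.single (coeffIdx 0 0 (by omega)) (c (coeffIdx 0 0 (by omega)))
      + Pi.single (coeffIdx 1 0 (by omega)) (c (coeffIdx 1 0 (by omega)))
      + Pi.single (coeffIdx 0 1 (by omega)) (c (coeffIdx 0 1 (by omega))) := by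
    funext q
    by_cases h : .inl q ∈ solvedParams hD
    · have hq := h
      have h0 : c' q = 0 := dif_pos h
      clear_value c'
      simp only [solvedParams, Finset.mem_insert, Finset.mem_singleton, Sum.inl.injEq,
        reduceCtorEq, or_false] at hq
      rcases hq with rfl | rfl | rfl <;> simp [h0]
    · have hq := h
      simp only [solvedParams, Finset.mem_insert, Finset.mem_singleton, Sum.inl.injEq,
        reduceCtorEq, or_false, not_or] at hq
      simp [c', h, hq, ht, auxPoint]
  have e1 := map_curveVal (eval t) c' x y
  have e2 := map_curveDx (eval t) c' x y
  have e3 := map_curveDy (eval t) c' x y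
  rw [hc] at h1 h2 h3
  simp only [curveVal_add, curveVal_single, curveDx_add, curveDx_single, curveDy_add,
    curveDy_single, ← e1, ← e2, ← e3] at h1 h2 h3
  simp at h1 h2 h3
  have k1 : eval t k₁₀ = c (coeffIdx 1 0 (by omega)) := by
    simp only [k₁₀, map_sub]
    linear_combination -h2
  have k2 : eval t k₀₁ = c (coeffIdx 0 1 (by omega)) := by
    simp only [k₀₁, map_sub]
    linear_combination -h3
  have k3 : eval t k₀₀ = c (coeffIdx 0 0 (by omega)) := by
    simp only [k₀₀, map_sub, map_neg, map_mul, k1, k2]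
    linear_combination -h1
  have k4 : eval t b = v 2 := by
    have e0 : t (.inl ⟨.inr (.inl 0), by simp [solvedParams]⟩) = v 0 := by simp [ht, auxPoint]
    have e1 : t (.inl ⟨.inr (.inl 1), by simp [solvedParams]⟩) = v 1 := by simp [ht, auxPoint]
    simp only [b, map_sub, map_mul, ← h4, linVal, eval_X, e0, e1]
    ring
  congr 2
  funext q
  by_cases h : q ∈ solvedParams hD
  · have hq := h
    simp only [solvedParams, Finset.mem_insert, Finset.mem_singleton] at hq
    simp only [φ, dif_pos h]
    rcases hq with rfl | rfl | rfl | rfl <;> simp [k1, k2, k3, k4]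
  · simp [φ, h, ht, auxPoint]

end Incidence

namespace Polynomial

section Elimination
variable {D : ℕ} {A B : Type*} [CommRing A] [CommRing B]

/-- The bivariate polynomial with the given coefficients, as a polynomial in the second variable
over polynomials in the first. -/
noncomputable def bivariate (w : CoeffIdx D → A) : A[X][X] :=
  ∑ q, C (C (w q) * X ^ (q.1.1 : ℕ)) * X ^ (q.1.2 : ℕ)

/-- The determinantal critical equation with denominators cleared. -/
noncomputable def critical (c : CoeffIdx D → A) (v u : Fin 3 → A) : A[X][X] :=
  (C (C (u 0 * v 0 + u 2 * v 0) * X ^ 1) * X ^ 0 + C (C (u 0 * v 1) * X ^ 0) * X ^ 1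
      + C (C (u 0 * v 2) * X ^ 0) * X ^ 0) * bivariate (fun q => (q.1.2 : ℕ) * c q)
    - (C (C (u 1 * v 0) * X ^ 1) * X ^ 0 + C (C (u 1 * v 1 + u 2 * v 1) * X ^ 0) * X ^ 1
      + C (C (u 1 * v 2) * X ^ 0) * X ^ 0) * bivariate (fun q => (q.1.1 : ℕ) * c q)

/-- The eliminant of the critical system in the first variable. -/
noncomputable def eliminant (c : CoeffIdx D → A) (v u : Fin 3 → A) : A[X] :=
  resultant (bivariate c) (critical c v u) D (D + 1)

lemma bivariate_map (φ : A →+* B) (w : CoeffIdx D → A) :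
    (bivariate w).map (mapRingHom φ) = bivariate (fun q => φ (w q)) := by
  simp [bivariate, Polynomial.map_sum]

lemma critical_map (φ : A →+* B) (c : CoeffIdx D → A) (v u : Fin 3 → A) :
    (critical c v u).map (mapRingHom φ) =
      critical (fun q => φ (c q)) (fun i => φ (v i)) (fun i => φ (u i)) := by
  simp [critical, bivariate_map]

lemma eliminant_map (φ : A →+* B) (c : CoeffIdx D → A) (v u : Fin 3 → A) :
    (eliminant c v u).map φ =
      eliminant (fun q => φ (c q)) (fun i => φ (v i)) (fun i => φ (u i)) := by
  rw [eliminant, ← coe_mapRingHom, ← resultant_map_map, bivariate_map, critical_map, eliminant]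

lemma totalDegLE_bivariate (w : CoeffIdx D → A) : TotalDegLE D (bivariate w) :=
  TotalDegLE.sum _ _ fun q _ => TotalDegLE.C_C_mul_X_pow_mul_X_pow _ q.2

lemma totalDegLE_critical (c : CoeffIdx D → A) (v u : Fin 3 → A) :
    TotalDegLE (D + 1) (critical c v u) := by
  rw [add_comm]
  refine .sub (.mul (.add (.add ?_ ?_) ?_) (totalDegLE_bivariate _))
    (.mul (.add (.add ?_ ?_) ?_) (totalDegLE_bivariate _)) <;>
  exact TotalDegLE.C_C_mul_X_pow_mul_X_pow _ (by omega)

lemma natDegree_eliminant_le (c : CoeffIdx D → A) (v u : Fin 3 → A) :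
    (eliminant c v u).natDegree ≤ D ^ 2 + D := by
  have := natDegree_resultant_le (totalDegLE_bivariate c) (totalDegLE_critical c v u)
  rwa [mul_add, mul_one, ← sq] at this

lemma evalEval_bivariate (w : CoeffIdx D → A) (x y : A) :
    (bivariate w).evalEval x y = curveVal w x y := by
  simp [bivariate, evalEval, curveVal, eval_finsetSum]

lemma evalEval_bivariate_fst (c : CoeffIdx D → A) (x y : A) :
    (bivariate fun q => (q.1.1 : ℕ) * c q).evalEval x y = x * curveDx c x y := by
  rw [evalEval_bivariate, curveVal, curveDx, Finset.mul_sum]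
  refine Finset.sum_congr rfl fun q _ => ?_
  cases (q.1.1 : ℕ) with
  | zero => simp
  | succ n => simp only [Nat.add_sub_cancel]; ring

lemma evalEval_bivariate_snd (c : CoeffIdx D → A) (x y : A) :
    (bivariate fun q => (q.1.2 : ℕ) * c q).evalEval x y = y * curveDy c x y := by
  rw [evalEval_bivariate, curveVal, curveDy, Finset.mul_sum]
  refine Finset.sum_congr rfl fun q _ => ?_
  cases (q.1.2 : ℕ) with
  | zero => simp
  | succ n => simp only [Nat.add_sub_cancel]; ring

lemma evalEval_critical (c : CoeffIdx D → A) (v u : Fin 3 → A) (x y : A) :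
    (critical c v u).evalEval x y =
      (u 0 * linVal v x y + u 2 * v 0 * x) * (y * curveDy c x y)
        - (u 1 * linVal v x y + u 2 * v 1 * y) * (x * curveDx c x y) := by
  rw [critical, evalEval_sub, evalEval_mul, evalEval_mul, evalEval_bivariate_fst,
    evalEval_bivariate_snd]
  simp [evalEval, linVal]
  ring

lemma bivariate_coeff_top (w : CoeffIdx D → A) :
    (bivariate w).coeff D = C (w (coeffIdx 0 D (by omega))) := by
  rw [bivariate, finsetSum_coeff, Finset.sum_eq_single (coeffIdx 0 D (by omega))]
  · simp [coeffIdx]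
  · rintro ⟨⟨i, j⟩, hq⟩ _ hne
    rw [coeff_C_mul, coeff_X_pow, if_neg, mul_zero]
    intro h
    simp only at h hq
    exact hne (Subtype.ext (Prod.ext (Fin.ext (show (i : ℕ) = 0 by omega))
      (Fin.ext (show (j : ℕ) = D by omega))))
  · simp

lemma eval_eliminant_eq_zero_iff (c : CoeffIdx D → ℂ) (v u : Fin 3 → ℂ)
    (hc : c (coeffIdx 0 D (by omega)) ≠ 0) (x : ℂ) :
    (eliminant c v u).eval x = 0 ↔
      ∃ y, curveVal c x y = 0 ∧ (critical c v u).evalEval x y = 0 := by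
  have htop : ((bivariate c).map (evalRingHom x)).coeff D ≠ 0 := by
    simpa [coeff_map, bivariate_coeff_top] using hc
  have hle : ((bivariate c).map (evalRingHom x)).natDegree ≤ D :=
    natDegree_map_le.trans (totalDegLE_bivariate c).natDegree_le
  rw [eliminant, ← coe_evalRingHom, ← resultant_map_map, resultant_eq_zero_iff_exists_root
    (le_antisymm hle (le_natDegree_of_ne_zero htop)) (fun h => htop (by simp [h]))
    (natDegree_map_le.trans (totalDegLE_critical c v u).natDegree_le)]
  simp only [eval_map, eval₂_evalRingHom, evalEval_bivariate]

lemma sq_dvd_eliminant (c : CoeffIdx D → ℂ) (v u : Fin 3 → ℂ) (hD : 1 ≤ D) {x y₁ y₂ : ℂ}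
    (hy : y₁ ≠ y₂) (h₁ : curveVal c x y₁ = 0) (h₁' : (critical c v u).evalEval x y₁ = 0)
    (h₂ : curveVal c x y₂ = 0) (h₂' : (critical c v u).evalEval x y₂ = 0) :
    (X - C x) ^ 2 ∣ eliminant c v u :=
  sq_dvd_resultant_of_common_zeros _ _ (totalDegLE_bivariate c).natDegree_le
    (totalDegLE_critical c v u).natDegree_le (by omega) hy (by rwa [evalEval_bivariate]) h₁'
    (by rwa [evalEval_bivariate]) h₂'

/-- The resultant of the eliminant and its derivative. -/
noncomputable def eliminantDisc (c : CoeffIdx D → A) (v u : Fin 3 → A) : A :=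
  resultant (eliminant c v u) (derivative (eliminant c v u)) (D ^ 2 + D) (D ^ 2 + D)

lemma map_eliminantDisc (φ : A →+* B) (c : CoeffIdx D → A) (v u : Fin 3 → A) :
    φ (eliminantDisc c v u) =
      eliminantDisc (fun q => φ (c q)) (fun i => φ (v i)) (fun i => φ (u i)) := by
  rw [eliminantDisc, ← resultant_map_map, ← derivative_map, eliminant_map, eliminantDisc]

lemma eliminantDisc_ne_zero_iff (c : CoeffIdx D → ℂ) (v u : Fin 3 → ℂ)
    (h : (eliminant c v u).coeff (D ^ 2 + D) ≠ 0) :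
    eliminantDisc c v u ≠ 0 ↔ (eliminant c v u).Separable := by
  have h0 : eliminant c v u ≠ 0 := fun h' => h (by simp [h'])
  rw [eliminantDisc, Ne, resultant_eq_zero_iff_exists_root
    (le_antisymm (natDegree_eliminant_le c v u) (le_natDegree_of_ne_zero h)) h0
    ((natDegree_derivative_le _).trans ((Nat.sub_le _ _).trans (natDegree_eliminant_le c v u)))]
  rw [← nodup_roots_iff_of_splits h0 (IsAlgClosed.splits _), Multiset.nodup_iff_count_le_one]
  simp only [count_roots]
  constructor
  · intro hne x
    by_contra hx
    push Not at hx
    have := (one_lt_rootMultiplicity_iff_isRoot h0).1 hx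
    exact hne ⟨x, this.1, this.2⟩
  · rintro hle ⟨x, hx, hx'⟩
    have := (one_lt_rootMultiplicity_iff_isRoot h0).2 ⟨hx, hx'⟩
    exact absurd (hle x) (by omega)

end Elimination

end Polynomial

/-- The polynomial `y^D + D y + D` separates `0`, `1` and its critical points, and does not vanish
there. -/
lemma critical_values {D : ℕ} (hD : 1 ≤ D) :
    ∃ S : Finset ℂ, S.card = D + 1 ∧
      (∀ y, y ∈ S ↔ (y - 1) * (y * (D * y ^ (D - 1) + D)) = 0) ∧
      (∀ y ∈ S, -(y ^ D + D * y + D) ≠ 0) ∧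
      Set.InjOn (fun y : ℂ => -(y ^ D + D * y + D)) S := by
  obtain ⟨n, rfl⟩ : ∃ n, D = n + 1 := ⟨D - 1, by omega⟩
  have hT : ∃ T : Finset ℂ, T.card = n ∧ ∀ y, y ∈ T ↔ y ^ n = -1 := by
    rcases Nat.eq_zero_or_pos n with rfl | hn
    · refine ⟨∅, rfl, fun y => ?_⟩
      norm_num [eq_neg_iff_add_eq_zero]
    · exact exists_finset_pow_eq n hn.ne' (by norm_num)
  obtain ⟨T, hTc, hTm⟩ := hT
  have hn : ∀ y : ℂ, y ^ n = -1 → n ≠ 0 := by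
    rintro y hy rfl
    norm_num [eq_neg_iff_add_eq_zero] at hy
  have hval : ∀ y : ℂ, y ^ n = -1 →
      y ^ (n + 1) + ((n + 1 : ℕ) : ℂ) * y + ((n + 1 : ℕ) : ℂ) = n * y + (n + 1) := by
    intro y hy
    rw [pow_succ, hy]
    push_cast
    ring
  have hnorm : ∀ y : ℂ, y ^ n = -1 → ‖(n : ℂ) * y‖ = n := by
    intro y hy
    have h1 : ‖y‖ ^ n = 1 := by rw [← norm_pow, hy]; simp
    rw [norm_mul, (pow_eq_one_iff_of_nonneg (norm_nonneg y) (hn y hy)).1 h1]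
    simp
  have hne0 : ∀ y : ℂ, y ^ n = -1 → y ≠ 0 := by
    rintro y hy rfl
    rw [zero_pow (hn 0 hy)] at hy
    norm_num at hy
  have h1T : (1 : ℂ) ∉ T := by
    rw [hTm, one_pow]
    norm_num [eq_neg_iff_add_eq_zero]
  have h0T : (0 : ℂ) ∉ T := fun h => hne0 0 ((hTm 0).1 h) rfl
  have hn1 : ((n : ℂ) + 1) ≠ 0 := by exact_mod_cast n.succ_ne_zero
  have hroot0 : ∀ y : ℂ, y ^ n = -1 → (n : ℂ) * y ≠ 0 := fun y hy =>
    mul_ne_zero (by exact_mod_cast hn y hy) (hne0 y hy)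
  have hroot1 : ∀ y : ℂ, y ^ n = -1 → (n : ℂ) * y ≠ n + 2 := by
    intro y hy h
    have h1 := hnorm y hy
    rw [h, show (n : ℂ) + 2 = ((n + 2 : ℕ) : ℂ) by push_cast; ring, Complex.norm_natCast] at h1
    push_cast at h1
    linarith
  refine ⟨insert 0 (insert 1 T), ?_, ?_, ?_, ?_⟩
  · rw [Finset.card_insert_of_notMem (by simp [h0T]), Finset.card_insert_of_notMem h1T, hTc]
  · intro y
    have : ((n + 1 : ℕ) : ℂ) * y ^ (n + 1 - 1) + ((n + 1 : ℕ) : ℂ) = (n + 1) * (y ^ n + 1) := by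
      rw [Nat.add_sub_cancel]
      push_cast
      ring
    rw [this]
    simp only [Finset.mem_insert, hTm, mul_eq_zero, hn1, false_or, sub_eq_zero,
      eq_neg_iff_add_eq_zero]
    tauto
  · intro y hy
    rw [neg_ne_zero]
    simp only [Finset.mem_insert, hTm] at hy
    rcases hy with rfl | rfl | hy
    · simpa using hn1
    · rw [one_pow]
      norm_cast
    · rw [hval y hy]
      intro h
      have h1 := hnorm y hy
      rw [eq_neg_of_add_eq_zero_left h, norm_neg,
        show (n : ℂ) + 1 = ((n + 1 : ℕ) : ℂ) by push_cast; ring, Complex.norm_natCast] at h1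
      push_cast at h1
      linarith
  · intro y hy y' hy' h
    simp only [neg_inj] at h
    simp only [Finset.coe_insert, Set.mem_insert_iff, Finset.mem_coe, hTm] at hy hy'
    have e0 : (0 : ℂ) ^ (n + 1) + ((n + 1 : ℕ) : ℂ) * 0 + ((n + 1 : ℕ) : ℂ) = n + 1 := by simp
    have e1 : (1 : ℂ) ^ (n + 1) + ((n + 1 : ℕ) : ℂ) * 1 + ((n + 1 : ℕ) : ℂ)
        = (n + 2) + (n + 1) := by
      simp
      ring
    have h2 : (n : ℂ) + 2 ≠ 0 := by exact_mod_cast (n + 1).succ_ne_zero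
    rcases hy with rfl | rfl | hy <;> rcases hy' with rfl | rfl | hy'
    · rfl
    · rw [e0, e1] at h
      exact absurd (by linear_combination -h) h2
    · rw [e0, hval y' hy'] at h
      exact absurd (by linear_combination -h) (hroot0 y' hy')
    · rw [e0, e1] at h
      exact absurd (by linear_combination h) h2
    · rfl
    · rw [e1, hval y' hy'] at h
      exact absurd (by linear_combination -h) (hroot1 y' hy')
    · rw [e0, hval y hy] at h
      exact absurd (by linear_combination h) (hroot0 y hy)
    · rw [e1, hval y hy] at h
      exact absurd (by linear_combination h) (hroot1 y hy)
    · rw [hval y hy, hval y' hy'] at h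
      exact mul_left_cancel₀ (a := (n : ℂ)) (by exact_mod_cast hn y hy) (by linear_combination h)

namespace Polynomial

/-- The critical system of `x^D + y^D + D y + D` with line `y = 1` and data `(1, 0, 0)` has a
separable eliminant of the expected degree. -/
lemma exists_separable_eliminant {D : ℕ} (hD : 1 ≤ D) :
    ∃ (c : CoeffIdx D → ℂ) (v u : Fin 3 → ℂ), c (coeffIdx 0 D (by omega)) ≠ 0 ∧
      (eliminant c v u).coeff (D ^ 2 + D) ≠ 0 ∧ (eliminant c v u).Separable ∧
      (eliminant c v u).eval 0 ≠ 0 := by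
  let c : CoeffIdx D → ℂ := Pi.single (coeffIdx D 0 (by omega)) 1
    + Pi.single (coeffIdx 0 D (by omega)) 1 + Pi.single (coeffIdx 0 1 (by omega)) (D : ℂ)
    + Pi.single (coeffIdx 0 0 (by omega)) (D : ℂ)
  let v : Fin 3 → ℂ := ![0, 1, -1]
  let u : Fin 3 → ℂ := ![1, 0, 0]
  have hf : ∀ x y, curveVal c x y = x ^ D + (y ^ D + D * y + D) := by
    intro x y
    simp only [c, curveVal_add, curveVal_single]
    ring
  have hQ : ∀ x y, (critical c v u).evalEval x y =
      (y - 1) * (y * (D * y ^ (D - 1) + D)) := by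
    intro x y
    rw [evalEval_critical]
    simp only [c, curveDy_add, curveDy_single, linVal]
    simp [u, v]
    left
    ring
  have hc : c (coeffIdx 0 D (by omega)) ≠ 0 := by
    have hD0 : D ≠ 0 := by omega
    by_cases h1 : D = 1
    · subst h1
      norm_num [c, Pi.single_apply]
    · simp [c, hD0, h1]
  obtain ⟨S, hScard, hSmem, hS0, hSinj⟩ := critical_values hD
  have hroot : ∀ x, (eliminant c v u).eval x = 0 ↔ ∃ y ∈ S, x ^ D = -(y ^ D + D * y + D) := by
    intro x
    rw [eval_eliminant_eq_zero_iff c v u hc]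
    simp only [hf, hQ, ← hSmem, eq_neg_iff_add_eq_zero]
    exact exists_congr fun y => and_comm
  have hex : ∀ y ∈ S, ∃ s : Finset ℂ, s.card = D ∧
      ∀ x, x ∈ s ↔ x ^ D = -(y ^ D + D * y + D) :=
    fun y hy => exists_finset_pow_eq D (by omega) (hS0 y hy)
  choose! s hscard hsmem using hex
  have hTcard : (S.biUnion s).card = D ^ 2 + D := by
    rw [Finset.card_biUnion, Finset.sum_congr rfl hscard, Finset.sum_const, hScard, smul_eq_mul]
    · ring
    · intro y hy y' hy' hne
      refine Finset.disjoint_left.2 fun x hx hx' => ?_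
      exact hne (hSinj hy hy' (((hsmem y hy x).1 hx).symm.trans ((hsmem y' hy' x).1 hx')))
  have hmem : ∀ x, x ∈ S.biUnion s ↔ (eliminant c v u).eval x = 0 := by
    intro x
    rw [hroot, Finset.mem_biUnion]
    exact exists_congr fun y => and_congr_right fun hy => hsmem y hy x
  have h0 : eliminant c v u ≠ 0 := by
    intro h
    obtain ⟨x, hx⟩ := Infinite.exists_notMem_finset (S.biUnion s)
    exact hx ((hmem x).2 (by simp [h]))
  have hroots : (eliminant c v u).roots.toFinset = S.biUnion s := by
    ext x
    simp [hmem, h0, -Finset.mem_biUnion]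
  have hle1 := Multiset.toFinset_card_le (eliminant c v u).roots
  have hle2 := card_roots' (eliminant c v u)
  have hle3 := natDegree_eliminant_le c v u
  rw [hroots, hTcard] at hle1
  refine ⟨c, v, u, hc, ?_, ?_, ?_⟩
  · rw [show D ^ 2 + D = (eliminant c v u).natDegree by omega]
    exact leadingCoeff_ne_zero.2 h0
  · rw [← nodup_roots_iff_of_splits h0 (IsAlgClosed.splits _),
      ← Multiset.toFinset_card_eq_card_iff_nodup, hroots, hTcard]
    omega
  · rw [Ne, hroot]
    rintro ⟨y, hy, h⟩
    rw [zero_pow (by omega)] at h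
    exact hS0 y hy h.symm

end Polynomial

/-- For generic parameters the eliminant is separable of the expected degree and does not vanish
at the origin. -/
lemma exists_generic_eliminant {D : ℕ} (hD : 1 ≤ D) :
    ∃ G : MvPolynomial (Param D) ℂ, G ≠ 0 ∧ ∀ (c : CoeffIdx D → ℂ) (v u : Fin 3 → ℂ),
      eval (Sum.elim c (Sum.elim v u)) G ≠ 0 → c (coeffIdx 0 D (by omega)) ≠ 0 ∧
      (Polynomial.eliminant c v u).natDegree = D ^ 2 + D ∧
      (Polynomial.eliminant c v u).Separable ∧ (Polynomial.eliminant c v u).eval 0 ≠ 0 := by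
  let cX : CoeffIdx D → MvPolynomial (Param D) ℂ := fun q => X (.inl q)
  let vX : Fin 3 → MvPolynomial (Param D) ℂ := fun i => X (.inr (.inl i))
  let uX : Fin 3 → MvPolynomial (Param D) ℂ := fun i => X (.inr (.inr i))
  let G := cX (coeffIdx 0 D (by omega)) * (Polynomial.eliminant cX vX uX).coeff (D ^ 2 + D)
    * Polynomial.eliminantDisc cX vX uX * (Polynomial.eliminant cX vX uX).coeff 0
  have hG : ∀ (c : CoeffIdx D → ℂ) (v u : Fin 3 → ℂ), eval (Sum.elim c (Sum.elim v u)) G =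
      c (coeffIdx 0 D (by omega)) * (Polynomial.eliminant c v u).coeff (D ^ 2 + D)
        * Polynomial.eliminantDisc c v u * (Polynomial.eliminant c v u).coeff 0 := by
    intro c v u
    simp only [G, map_mul, Polynomial.map_eliminantDisc, ← Polynomial.coeff_map,
      Polynomial.eliminant_map]
    simp [cX, vX, uX]
  refine ⟨G, ?_, fun c v u h => ?_⟩
  · obtain ⟨c, v, u, hc, htop, hsep, h0⟩ := Polynomial.exists_separable_eliminant hD
    intro h
    have := hG c v u
    rw [h, map_zero, eq_comm] at this
    rw [← Polynomial.coeff_zero_eq_eval_zero] at h0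
    exact mul_ne_zero (mul_ne_zero (mul_ne_zero hc htop)
      ((Polynomial.eliminantDisc_ne_zero_iff c v u htop).2 hsep)) h0 this
  · rw [hG] at h
    obtain ⟨h, h0⟩ := mul_ne_zero_iff.1 h
    obtain ⟨h, hdisc⟩ := mul_ne_zero_iff.1 h
    obtain ⟨hc, htop⟩ := mul_ne_zero_iff.1 h
    refine ⟨hc, le_antisymm (Polynomial.natDegree_eliminant_le c v u)
      (Polynomial.le_natDegree_of_ne_zero htop),
      (Polynomial.eliminantDisc_ne_zero_iff c v u htop).1 hdisc, ?_⟩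
    rwa [← Polynomial.coeff_zero_eq_eval_zero]

/-- For generic parameters the curve is smooth, it has no common point with the axis `y = 0` and
the line, it is transverse to the axis `y = 0`, and it is transverse to the line. -/
lemma exists_generic_transversality {D : ℕ} (hD : 1 ≤ D) :
    ∃ G : MvPolynomial (Param D) ℂ, G ≠ 0 ∧ ∀ (c : CoeffIdx D → ℂ) (v u : Fin 3 → ℂ),
      eval (Sum.elim c (Sum.elim v u)) G ≠ 0 → ∀ x y, curveVal c x y = 0 →
      (curveDx c x y ≠ 0 ∨ curveDy c x y ≠ 0) ∧
      (y = 0 → curveDx c x y ≠ 0) ∧ (y = 0 → linVal v x y ≠ 0) ∧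
      (linVal v x y = 0 → ∀ k, ¬ (curveDx c x y = k * v 0 ∧ curveDy c x y = k * v 1)) := by
  obtain ⟨G₁, hG₁, h₁⟩ := exists_hypersurface_of_incidence hD
    (X (.inr 0)) (X (.inr 1)) 0 0 (X (.inr 2))
  obtain ⟨G₂, hG₂, h₂⟩ := exists_hypersurface_of_incidence hD
    (X (.inr 0)) 0 0 (X (.inr 1)) (X (.inr 2))
  obtain ⟨G₃, hG₃, h₃⟩ := exists_hypersurface_of_incidence hD
    (X (.inr 0)) 0 (X (.inr 1)) (X (.inr 2)) 0
  obtain ⟨G₄, hG₄, h₄⟩ := exists_hypersurface_of_incidence hD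
    (X (.inr 0)) (X (.inr 1))
    (X (.inr 2) * X (.inl ⟨.inr (.inl 0), by simp [solvedParams]⟩))
    (X (.inr 2) * X (.inl ⟨.inr (.inl 1), by simp [solvedParams]⟩)) 0
  refine ⟨G₁ * G₂ * G₃ * G₄, mul_ne_zero (mul_ne_zero (mul_ne_zero hG₁ hG₂) hG₃) hG₄, ?_⟩
  intro c v u h x y hf
  simp only [map_mul] at h
  obtain ⟨h, n₄⟩ := mul_ne_zero_iff.1 h
  obtain ⟨h, n₃⟩ := mul_ne_zero_iff.1 h
  obtain ⟨n₁, n₂⟩ := mul_ne_zero_iff.1 h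
  refine ⟨?_, ?_, ?_, ?_⟩
  · by_contra! hd
    exact n₁ (h₁ c v u ⟨![x, y, linVal v x y], by simp [auxPoint, hf, hd]⟩)
  · rintro rfl hd
    exact n₂ (h₂ c v u ⟨![x, curveDy c x 0, linVal v x 0], by simp [auxPoint, hf, hd]⟩)
  · rintro rfl hl
    exact n₃ (h₃ c v u ⟨![x, curveDx c x 0, curveDy c x 0], by simp [auxPoint, hf, hl]⟩)
  · rintro hl k ⟨hx, hy⟩
    exact n₄ (h₄ c v u ⟨![x, y, k], by simp [auxPoint, hf, hl, hx, hy]⟩)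

/-- Off the coordinate axes and the line, at a smooth point, the cleared critical equation is
equivalent to the existence of a Lagrange multiplier. -/
lemma exists_multiplier_iff {D : ℕ} (c : CoeffIdx D → ℂ) (v u : Fin 3 → ℂ) {x y : ℂ}
    (hx : x ≠ 0) (hy : y ≠ 0) (hl : linVal v x y ≠ 0)
    (hs : curveDx c x y ≠ 0 ∨ curveDy c x y ≠ 0) :
    (∃ lam : ℂ, u 0 / x + u 2 * v 0 / linVal v x y = lam * curveDx c x y ∧
      u 1 / y + u 2 * v 1 / linVal v x y = lam * curveDy c x y) ↔
      (Polynomial.critical c v u).evalEval x y = 0 := by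
  have key : (Polynomial.critical c v u).evalEval x y = x * y * linVal v x y *
      ((u 0 / x + u 2 * v 0 / linVal v x y) * curveDy c x y
        - (u 1 / y + u 2 * v 1 / linVal v x y) * curveDx c x y) := by
    rw [Polynomial.evalEval_critical]
    field_simp
  rw [key, mul_eq_zero, or_iff_right (mul_ne_zero (mul_ne_zero hx hy) hl), sub_eq_zero]
  generalize u 0 / x + u 2 * v 0 / linVal v x y = a
  generalize u 1 / y + u 2 * v 1 / linVal v x y = b
  constructor
  · rintro ⟨lam, rfl, rfl⟩
    ring
  · intro h
    rcases hs with hs | hs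
    · exact ⟨a / curveDx c x y, by field_simp, by field_simp; linear_combination -h⟩
    · exact ⟨b / curveDy c x y, by field_simp; linear_combination h, by field_simp⟩

/-- **The first removal ML degree of a general degree-`D` very affine plane curve is
`r₁ = D² + D`.**  There is a nonzero polynomial `G` in the coefficients `c_{ij}`, the
hyperplane parameters `(a₁, a₂, b)` (encoded as `v 0, v 1, v 2`) and `(u₁, u₂, u₃)`
such that whenever `G ≠ 0`, the curve `f_c` has exactly `D² + D` ML-critical points
with the hyperplane `ℓ = a₁z₁ + a₂z₂ + b` removed. -/
theorem removal_ml_degree_one_general_plane_curve (D : ℕ) (hD : 1 ≤ D) :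
    ∃ G : MvPolynomial (CoeffIdx D ⊕ (Fin 3 ⊕ Fin 3)) ℂ, G ≠ 0 ∧
      ∀ (c : CoeffIdx D → ℂ) (v : Fin 3 → ℂ) (u : Fin 3 → ℂ),
        eval (Sum.elim c (Sum.elim v u)) G ≠ 0 →
          {z : Fin 2 → ℂ | (∀ i, z i ≠ 0) ∧ eval z (planeCurve D c) = 0 ∧
              v 0 * z 0 + v 1 * z 1 + v 2 ≠ 0 ∧
              ∃ lam : ℂ,
                u 0 / z 0 + u 2 * v 0 / (v 0 * z 0 + v 1 * z 1 + v 2)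
                  = lam * eval z (pderiv 0 (planeCurve D c)) ∧
                u 1 / z 1 + u 2 * v 1 / (v 0 * z 0 + v 1 * z 1 + v 2)
                  = lam * eval z (pderiv 1 (planeCurve D c))}.ncard
            = D ^ 2 + D := by
  obtain ⟨G₁, hG₁, h₁⟩ := exists_generic_eliminant hD
  obtain ⟨G₂, hG₂, h₂⟩ := exists_generic_transversality hD
  refine ⟨G₁ * G₂ * X (.inr (.inl 0)) * X (.inr (.inr 1)) * X (.inr (.inr 2)),
    by simp [hG₁, hG₂, X_ne_zero], fun c v u h => ?_⟩
  simp only [map_mul, mul_ne_zero_iff, eval_X, Sum.elim_inl, Sum.elim_inr] at h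
  obtain ⟨⟨⟨⟨n₁, n₂⟩, hv⟩, hu₁⟩, hu₂⟩ := h
  obtain ⟨hc, hdeg, hsep, h0⟩ := h₁ c v u n₁
  have htrans := h₂ c v u n₂
  set R := Polynomial.eliminant c v u with hR
  have hR0 : R ≠ 0 := fun h => h0 (by simp [h])
  have hnodup : R.roots.Nodup := Polynomial.nodup_roots hsep
  have hgood : ∀ x y, curveVal c x y = 0 → (Polynomial.critical c v u).evalEval x y = 0 →
      x ≠ 0 ∧ y ≠ 0 ∧ linVal v x y ≠ 0 := by
    intro x y hf hQ
    obtain ⟨-, hy1, hy2, hl⟩ := htrans x y hf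
    have hx : x ≠ 0 := by
      rintro rfl
      exact h0 ((Polynomial.eval_eliminant_eq_zero_iff c v u hc 0).2 ⟨y, hf, hQ⟩)
    rw [Polynomial.evalEval_critical] at hQ
    have hy : y ≠ 0 := by
      intro hy
      have : u 1 * linVal v x y * (x * curveDx c x y) = 0 := by
        rw [hy] at hQ ⊢
        linear_combination -hQ
      exact mul_ne_zero (mul_ne_zero hu₁ (hy2 hy)) (mul_ne_zero hx (hy1 hy)) this
    refine ⟨hx, hy, fun hl0 => ?_⟩
    refine hl hl0 (curveDx c x y / v 0) ⟨by field_simp, ?_⟩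
    rw [hl0] at hQ
    have : u 2 * x * y * (v 0 * curveDy c x y - v 1 * curveDx c x y) = 0 := by
      linear_combination hQ
    have := (mul_eq_zero.1 this).resolve_left (mul_ne_zero (mul_ne_zero hu₂ hx) hy)
    field_simp
    linear_combination this
  have hset : {z : Fin 2 → ℂ | (∀ i, z i ≠ 0) ∧ eval z (planeCurve D c) = 0 ∧
      v 0 * z 0 + v 1 * z 1 + v 2 ≠ 0 ∧ ∃ lam : ℂ,
        u 0 / z 0 + u 2 * v 0 / (v 0 * z 0 + v 1 * z 1 + v 2)
          = lam * eval z (pderiv 0 (planeCurve D c)) ∧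
        u 1 / z 1 + u 2 * v 1 / (v 0 * z 0 + v 1 * z 1 + v 2)
          = lam * eval z (pderiv 1 (planeCurve D c))} =
      {z | curveVal c (z 0) (z 1) = 0 ∧
        (Polynomial.critical c v u).evalEval (z 0) (z 1) = 0} := by
    ext z
    simp only [Set.mem_ofPred_eq, eval_planeCurve, eval_pderiv_zero_planeCurve,
      eval_pderiv_one_planeCurve, Fin.forall_fin_two]
    constructor
    · rintro ⟨⟨hx, hy⟩, hf, hl, hlam⟩
      exact ⟨hf, (exists_multiplier_iff c v u hx hy hl (htrans _ _ hf).1).1 hlam⟩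
    · rintro ⟨hf, hQ⟩
      obtain ⟨hx, hy, hl⟩ := hgood _ _ hf hQ
      exact ⟨⟨hx, hy⟩, hf, hl,
        (exists_multiplier_iff c v u hx hy hl (htrans _ _ hf).1).2 hQ⟩
  rw [hset]
  have himage : (fun z : Fin 2 → ℂ => z 0) '' {z | curveVal c (z 0) (z 1) = 0 ∧
      (Polynomial.critical c v u).evalEval (z 0) (z 1) = 0} = R.roots.toFinset := by
    ext x
    rw [Finset.mem_coe, Multiset.mem_toFinset, Polynomial.mem_roots hR0, Polynomial.IsRoot, hR,
      Polynomial.eval_eliminant_eq_zero_iff c v u hc]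
    simp only [Set.mem_image, Set.mem_ofPred_eq]
    constructor
    · rintro ⟨z, hz, rfl⟩
      exact ⟨z 1, hz⟩
    · rintro ⟨y, hy⟩
      exact ⟨![x, y], by simpa using hy, rfl⟩
  rw [← Set.InjOn.ncard_image (f := fun z : Fin 2 → ℂ => z 0), himage, Set.ncard_coe_finset,
    Multiset.toFinset_card_of_nodup hnodup, ← (IsAlgClosed.splits R).natDegree_eq_card_roots, hdeg]
  rintro z ⟨hz, hz'⟩ w ⟨hw, hw'⟩ hzw
  change z 0 = w 0 at hzw
  by_contra hne
  have hy : z 1 ≠ w 1 := fun h => hne (funext (Fin.forall_fin_two.2 ⟨hzw, h⟩))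
  rw [← hzw] at hw hw'
  have hdvd := Polynomial.sq_dvd_eliminant c v u hD hy hz hz' hw hw'
  have h2 := (Polynomial.le_rootMultiplicity_iff hR0).2 hdvd
  rw [← Polynomial.count_roots] at h2
  have := Multiset.nodup_iff_count_le_one.1 hnodup (z 0)
  omega
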